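/- arXiv:2503.18517 — 2 statements merged into one kernel-verified Lean document; each statement's English description precedes it below -/
import Mathlib

section
/- If p/q and r/s are distinct elements of ℚ(H₄) (with q, s > 0), then |p·s − r·q| ≥ 1. -/
/-- A matrix (p, r; q, s) has the first H4 form (without sign). -/
def H4form (p r q s : ℝ) : Prop :=
  (∃ a b c d : ℤ, Odd a ∧ Odd d ∧ a * d - 2 * b * c = 1 ∧
     p = (a : ℝ) ∧ r = Real.sqrt 2 * b ∧ q = Real.sqrt 2 * c ∧ s = (d : ℝ)) ∨
  (∃ a b c d : ℤ, Odd b ∧ Odd c ∧ 2 * a * d - b * c = 1 ∧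
     p = Real.sqrt 2 * a ∧ r = (b : ℝ) ∧ q = (c : ℝ) ∧ s = Real.sqrt 2 * d)

/-- The matrix (p, r; q, s) belongs to the Hecke group H4 (up to sign). -/
def H4 (p r q s : ℝ) : Prop := H4form p r q s ∨ H4form (-p) (-r) (-q) (-s)

/-- p/q ∈ ℚ(H₄): q > 0 and (p, r; q, s) ∈ H₄ for some reals r, s. -/
def QH4 (p q : ℝ) : Prop := 0 < q ∧ ∃ r s : ℝ, H4 p r q s

/-- α ∉ √2·ℚ. -/
def NotSqrt2Rat (α : ℝ) : Prop := ¬ ∃ x : ℚ, α = Real.sqrt 2 * (x : ℝ)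

theorem QH4.exists_int {p q : ℝ} (h : QH4 p q) :
    ∃ m n : ℤ, (p = m ∧ q = √2 * n) ∨ (p = √2 * m ∧ q = n) := by
  obtain ⟨-, r, s, (⟨a, b, c, d, -, -, -, h₁, -, h₂, -⟩ | ⟨a, b, c, d, -, -, -, h₁, -, h₂, -⟩) |
    (⟨a, b, c, d, -, -, -, h₁, -, h₂, -⟩ | ⟨a, b, c, d, -, -, -, h₁, -, h₂, -⟩)⟩ := h
  · exact ⟨a, c, .inl ⟨h₁, h₂⟩⟩
  · exact ⟨a, c, .inr ⟨h₁, h₂⟩⟩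
  · exact ⟨-a, -c, .inl ⟨by push_cast; linarith, by push_cast; linarith⟩⟩
  · exact ⟨-a, -c, .inr ⟨by push_cast; linarith, by push_cast; linarith⟩⟩

theorem one_le_abs_intCast_of_ne_zero {n : ℤ} (h : (n : ℝ) ≠ 0) : 1 ≤ |(n : ℝ)| := by
  exact_mod_cast Int.one_le_abs (Int.cast_ne_zero.mp h)

theorem one_le_abs_sqrt_two_mul_intCast {n : ℤ} (h : √2 * (n : ℝ) ≠ 0) :
    1 ≤ |√2 * (n : ℝ)| := by
  rw [abs_mul, abs_of_nonneg (Real.sqrt_nonneg 2)]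
  exact one_le_mul_of_one_le_of_one_le (Real.one_le_sqrt.mpr one_le_two)
    (one_le_abs_intCast_of_ne_zero (right_ne_zero_of_mul h))

theorem discriminant_ge_one (p q r s : ℝ)
    (hpq : QH4 p q) (hrs : QH4 r s) (hne : p / q ≠ r / s) :
    1 ≤ |p * s - r * q| := by
  have hdet : p * s - r * q ≠ 0 := fun h =>
    hne ((div_eq_div_iff hpq.1.ne' hrs.1.ne').mpr (sub_eq_zero.mp h))
  have hsq : √2 * √2 = (2 : ℝ) := Real.mul_self_sqrt zero_le_two
  obtain ⟨a, c, ⟨rfl, rfl⟩ | ⟨rfl, rfl⟩⟩ := hpq.exists_int <;>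
    obtain ⟨b, d, ⟨rfl, rfl⟩ | ⟨rfl, rfl⟩⟩ := hrs.exists_int
  · have h : a * (√2 * d) - b * (√2 * c) = √2 * ((a * d - b * c : ℤ) : ℝ) := by
      push_cast; ring
    rw [h] at hdet ⊢
    exact one_le_abs_sqrt_two_mul_intCast hdet
  · have h : a * d - √2 * b * (√2 * c) = ((a * d - 2 * b * c : ℤ) : ℝ) := by
      push_cast; linear_combination -(b * c : ℝ) * hsq
    rw [h] at hdet ⊢
    exact one_le_abs_intCast_of_ne_zero hdet
  · have h : √2 * a * (√2 * d) - b * c = ((2 * a * d - b * c : ℤ) : ℝ) := by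
      push_cast; linear_combination (a * d : ℝ) * hsq
    rw [h] at hdet ⊢
    exact one_le_abs_intCast_of_ne_zero hdet
  · have h : √2 * a * d - √2 * b * c = √2 * ((a * d - b * c : ℤ) : ℝ) := by
      push_cast; ring
    rw [h] at hdet ⊢
    exact one_le_abs_sqrt_two_mul_intCast hdet
end

section
/- Let α > 0 be a real number with α ∉ √2·ℚ, with H₄-expansion data G_n = (t_n, v_n; u_n, w_n), α_n = (w_n·α − v_n)/(t_n − u_n·α), α*_n = w_n/u_n. For every n ≥ m(α)+1, the fraction t_n/u_n is an H₄-best approximation of α if and only if α_n > 1 or α*_n > 1. -/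
/-- p/q ∈ ℚ(H₄) is an H₄-best approximation of α. -/
def IsBest (α p q : ℝ) : Prop :=
  QH4 p q ∧ ∀ r s : ℝ, QH4 r s → r / s ≠ p / q → s ≤ q → |q * α - p| < |s * α - r|

/-- The matrices A₁, A₂, A₃ generating the H₄-expansion. -/
noncomputable def Amat : ℕ → Matrix (Fin 2) (Fin 2) ℝ
  | 1 => !![1, 0; Real.sqrt 2, 1]
  | 2 => !![Real.sqrt 2, 1; 1, Real.sqrt 2]
  | _ => !![1, Real.sqrt 2; 0, 1]

/-- G_n = A_{d₁} ⋯ A_{d_n}. -/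
noncomputable def Gmat (d : ℕ → ℕ) (n : ℕ) : Matrix (Fin 2) (Fin 2) ℝ :=
  ((List.range n).map (fun i => Amat (d (i + 1)))).prod

noncomputable def tn (d : ℕ → ℕ) (n : ℕ) : ℝ := Gmat d n 0 0
noncomputable def vn (d : ℕ → ℕ) (n : ℕ) : ℝ := Gmat d n 0 1
noncomputable def un (d : ℕ → ℕ) (n : ℕ) : ℝ := Gmat d n 1 0
noncomputable def wn (d : ℕ → ℕ) (n : ℕ) : ℝ := Gmat d n 1 1

/-- α_n = G_n⁻¹ · α. -/
noncomputable def alphan (d : ℕ → ℕ) (α : ℝ) (n : ℕ) : ℝ :=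
  (wn d n * α - vn d n) / (tn d n - un d n * α)

/-- α*_n = w_n / u_n. -/
noncomputable def alphast (d : ℕ → ℕ) (n : ℕ) : ℝ := wn d n / un d n

/-- An integer or `√2` times an integer. -/
def IsIntOrSqrtTwoMulInt (x : ℝ) : Prop :=
  (∃ k : ℤ, x = k) ∨ ∃ k : ℤ, x = Real.sqrt 2 * k

lemma sqrt_two_mul_self : Real.sqrt 2 * Real.sqrt 2 = 2 :=
  Real.mul_self_sqrt (by norm_num)

lemma IsIntOrSqrtTwoMulInt.eq_zero_or_one_le_abs {x : ℝ} (h : IsIntOrSqrtTwoMulInt x) :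
    x = 0 ∨ 1 ≤ |x| := by
  have key : ∀ k : ℤ, k = 0 ∨ (1 : ℝ) ≤ |(k : ℝ)| := fun k => by
    rcases eq_or_ne k 0 with hk | hk
    · exact Or.inl hk
    · exact Or.inr (by exact_mod_cast Int.one_le_abs hk)
  rcases h with ⟨k, rfl⟩ | ⟨k, rfl⟩
  · rcases key k with rfl | hk
    · simp
    · exact Or.inr hk
  · rcases key k with rfl | hk
    · simp
    · right
      rw [abs_mul, abs_of_nonneg (Real.sqrt_nonneg 2)]
      have : 1 ≤ Real.sqrt 2 := Real.one_le_sqrt.2 (by norm_num)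
      nlinarith

lemma H4form.det_eq_one {p r q s : ℝ} (h : H4form p r q s) : p * s - r * q = 1 := by
  rcases h with ⟨a, b, c, d, -, -, h, rfl, rfl, rfl, rfl⟩ | ⟨a, b, c, d, -, -, h, rfl, rfl, rfl, rfl⟩
  · have h' : (a : ℝ) * d - 2 * b * c = 1 := by exact_mod_cast h
    linear_combination h' - (b : ℝ) * c * sqrt_two_mul_self
  · have h' : 2 * (a : ℝ) * d - b * c = 1 := by exact_mod_cast h
    linear_combination h' + (a : ℝ) * d * sqrt_two_mul_self

lemma H4form.mul_one {p r q s : ℝ} (h : H4form p r q s) :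
    H4form (p + r * Real.sqrt 2) r (q + s * Real.sqrt 2) s := by
  rcases h with ⟨a, b, c, d, ha, hd, h, rfl, rfl, rfl, rfl⟩ | ⟨a, b, c, d, hb, hc, h, rfl, rfl, rfl, rfl⟩
  · refine Or.inl ⟨a + 2 * b, b, c + d, d, by grind, hd, by linear_combination h, ?_, rfl, ?_, rfl⟩
    · push_cast
      linear_combination (b : ℝ) * sqrt_two_mul_self
    · push_cast
      ring
  · refine Or.inr ⟨a + b, b, c + 2 * d, d, hb, by grind, by linear_combination h, ?_, rfl, ?_, rfl⟩
    · push_cast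
      ring
    · push_cast
      linear_combination (d : ℝ) * sqrt_two_mul_self

lemma H4form.mul_two {p r q s : ℝ} (h : H4form p r q s) :
    H4form (p * Real.sqrt 2 + r) (p + r * Real.sqrt 2)
      (q * Real.sqrt 2 + s) (q + s * Real.sqrt 2) := by
  rcases h with ⟨a, b, c, d, ha, hd, h, rfl, rfl, rfl, rfl⟩ | ⟨a, b, c, d, hb, hc, h, rfl, rfl, rfl, rfl⟩
  · refine Or.inr ⟨a + b, a + 2 * b, 2 * c + d, c + d, by grind, by grind,
      by linear_combination h, ?_, ?_, ?_, ?_⟩ <;> push_cast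
    · ring
    · linear_combination (b : ℝ) * sqrt_two_mul_self
    · linear_combination (c : ℝ) * sqrt_two_mul_self
    · ring
  · refine Or.inl ⟨2 * a + b, a + b, c + d, c + 2 * d, by grind, by grind,
      by linear_combination h, ?_, ?_, ?_, ?_⟩ <;> push_cast
    · linear_combination (a : ℝ) * sqrt_two_mul_self
    · ring
    · ring
    · linear_combination (d : ℝ) * sqrt_two_mul_self

lemma H4form.mul_three {p r q s : ℝ} (h : H4form p r q s) :
    H4form p (p * Real.sqrt 2 + r) q (q * Real.sqrt 2 + s) := by
  rcases h with ⟨a, b, c, d, ha, hd, h, rfl, rfl, rfl, rfl⟩ | ⟨a, b, c, d, hb, hc, h, rfl, rfl, rfl, rfl⟩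
  · refine Or.inl ⟨a, a + b, c, 2 * c + d, ha, by grind, by linear_combination h, rfl, ?_, rfl, ?_⟩
    · push_cast
      ring
    · push_cast
      linear_combination (c : ℝ) * sqrt_two_mul_self
  · refine Or.inr ⟨a, 2 * a + b, c, c + d, by grind, hc, by linear_combination h, rfl, ?_, rfl, ?_⟩
    · push_cast
      linear_combination (a : ℝ) * sqrt_two_mul_self
    · push_cast
      ring

/-- `H4form` is stable under swapping the columns and negating one of them. -/
lemma H4form.swap {p r q s : ℝ} (h : H4form p r q s) : H4form r (-p) s (-q) := by
  rcases h with ⟨a, b, c, d, ha, hd, h, rfl, rfl, rfl, rfl⟩ | ⟨a, b, c, d, hb, hc, h, rfl, rfl, rfl, rfl⟩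
  · exact Or.inr ⟨b, -a, d, -c, ha.neg, hd, by linear_combination h, rfl, by simp, rfl, by simp⟩
  · exact Or.inl ⟨b, -a, d, -c, hb, hc.neg, by linear_combination h, rfl, by simp, rfl, by simp⟩

/-- A column of an element of `H₄`: one entry is an integer, the other `√2` times an integer. -/
lemma H4.column {p r q s : ℝ} (h : H4 p r q s) :
    (∃ a c : ℤ, p = a ∧ q = Real.sqrt 2 * c) ∨ ∃ a c : ℤ, p = Real.sqrt 2 * a ∧ q = c := by
  rcases h with h | h <;>
    rcases h with ⟨a, b, c, d, -, -, -, hp, -, hq, -⟩ | ⟨a, b, c, d, -, -, -, hp, -, hq, -⟩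
  · exact Or.inl ⟨a, c, hp, hq⟩
  · exact Or.inr ⟨a, c, hp, hq⟩
  · exact Or.inl ⟨-a, -c, by push_cast; linarith, by push_cast; linarith⟩
  · exact Or.inr ⟨-a, -c, by push_cast; linarith, by push_cast; linarith⟩

/-- The symplectic pairing of two columns of elements of `H₄`. -/
lemma H4.isIntOrSqrtTwoMulInt_cross {p r q s p' r' q' s' : ℝ}
    (h : H4 p r q s) (h' : H4 p' r' q' s') : IsIntOrSqrtTwoMulInt (p * q' - q * p') := by
  rcases h.column with ⟨a, c, rfl, rfl⟩ | ⟨a, c, rfl, rfl⟩ <;>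
    rcases h'.column with ⟨a', c', rfl, rfl⟩ | ⟨a', c', rfl, rfl⟩
  · exact Or.inr ⟨a * c' - c * a', by push_cast; ring⟩
  · exact Or.inl ⟨a * c' - 2 * c * a', by
      push_cast; linear_combination (-(c : ℝ) * a') * sqrt_two_mul_self⟩
  · exact Or.inl ⟨2 * a * c' - c * a', by
      push_cast; linear_combination ((a : ℝ) * c') * sqrt_two_mul_self⟩
  · exact Or.inr ⟨a * c' - c * a', by push_cast; ring⟩

lemma Gmat_succ (d : ℕ → ℕ) (n : ℕ) : Gmat d (n + 1) = Gmat d n * Amat (d (n + 1)) := by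
  simp [Gmat, List.range_succ]

/-- How the entries of `G_n` change with `n`, by the value of the new digit. -/
lemma entries_succ (d : ℕ → ℕ) (n : ℕ) (h : d (n + 1) = 1 ∨ d (n + 1) = 2 ∨ d (n + 1) = 3) :
    (d (n + 1) = 1 ∧ tn d (n + 1) = tn d n + vn d n * Real.sqrt 2 ∧ vn d (n + 1) = vn d n ∧
      un d (n + 1) = un d n + wn d n * Real.sqrt 2 ∧ wn d (n + 1) = wn d n) ∨
    (d (n + 1) = 2 ∧ tn d (n + 1) = tn d n * Real.sqrt 2 + vn d n ∧
      vn d (n + 1) = tn d n + vn d n * Real.sqrt 2 ∧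
      un d (n + 1) = un d n * Real.sqrt 2 + wn d n ∧
      wn d (n + 1) = un d n + wn d n * Real.sqrt 2) ∨
    (d (n + 1) = 3 ∧ tn d (n + 1) = tn d n ∧ vn d (n + 1) = tn d n * Real.sqrt 2 + vn d n ∧
      un d (n + 1) = un d n ∧ wn d (n + 1) = un d n * Real.sqrt 2 + wn d n) := by
  rcases h with h | h | h
  · refine Or.inl ⟨h, ?_⟩
    simp [tn, vn, un, wn, Gmat_succ, h, Amat, Matrix.mul_apply, Fin.sum_univ_two]
  · refine Or.inr (Or.inl ⟨h, ?_⟩)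
    simp [tn, vn, un, wn, Gmat_succ, h, Amat, Matrix.mul_apply, Fin.sum_univ_two]
  · refine Or.inr (Or.inr ⟨h, ?_⟩)
    simp [tn, vn, un, wn, Gmat_succ, h, Amat, Matrix.mul_apply, Fin.sum_univ_two]

lemma H4form_entries (d : ℕ → ℕ) (hd : ∀ n : ℕ, 1 ≤ n → d n = 1 ∨ d n = 2 ∨ d n = 3) (n : ℕ) :
    H4form (tn d n) (vn d n) (un d n) (wn d n) := by
  induction n with
  | zero => exact Or.inl ⟨1, 0, 0, 1, by simp [tn, vn, un, wn, Gmat]⟩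
  | succ n ih =>
    rcases entries_succ d n (hd _ n.succ_pos) with ⟨-, ht, hv, hu, hw⟩ | ⟨-, ht, hv, hu, hw⟩ |
      ⟨-, ht, hv, hu, hw⟩ <;> rw [ht, hv, hu, hw]
    · exact ih.mul_one
    · exact ih.mul_two
    · exact ih.mul_three

lemma un_nonneg_and_wn_pos (d : ℕ → ℕ) (hd : ∀ n : ℕ, 1 ≤ n → d n = 1 ∨ d n = 2 ∨ d n = 3)
    (n : ℕ) : 0 ≤ un d n ∧ 0 < wn d n := by
  induction n with
  | zero => simp [un, wn, Gmat]
  | succ n ih =>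
    obtain ⟨ihu, ihw⟩ := ih
    rcases entries_succ d n (hd _ n.succ_pos) with ⟨-, -, -, hu, hw⟩ | ⟨-, -, -, hu, hw⟩ |
      ⟨-, -, -, hu, hw⟩ <;> rw [hu, hw] <;> constructor <;> positivity

lemma un_pos (d : ℕ → ℕ) (hd : ∀ n : ℕ, 1 ≤ n → d n = 1 ∨ d n = 2 ∨ d n = 3)
    {m n : ℕ} (hm : d (m + 1) ≠ 3) (hn : m + 1 ≤ n) : 0 < un d n := by
  induction n, hn using Nat.le_induction with
  | base =>
    obtain ⟨hu, hw⟩ := un_nonneg_and_wn_pos d hd m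
    rcases entries_succ d m (hd _ m.succ_pos) with ⟨-, -, -, h, -⟩ | ⟨-, -, -, h, -⟩ | ⟨h, -⟩
    · rw [h]; positivity
    · rw [h]; positivity
    · exact absurd h hm
  | succ n _ ih =>
    obtain ⟨-, hw⟩ := un_nonneg_and_wn_pos d hd n
    rcases entries_succ d n (hd _ n.succ_pos) with ⟨-, -, -, h, -⟩ | ⟨-, -, -, h, -⟩ |
      ⟨-, -, -, h, -⟩ <;> rw [h] <;> positivity

/-- Best approximation criterion for a column of an element of `H₄`. -/
lemma isBest_iff_of_H4form {α t v u w : ℝ} (h : H4form t v u w) (hu : 0 < u) (hw : 0 < w)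
    (hv : v < w * α) (ht : u * α < t) :
    IsBest α t u ↔ (1 < (w * α - v) / (t - u * α) ∨ 1 < w / u) := by
  have hdet := h.det_eq_one
  have hδ : 0 < t - u * α := sub_pos.2 ht
  have hε : 0 < w * α - v := sub_pos.2 hv
  have habs : |u * α - t| = t - u * α := by rw [abs_sub_comm, abs_of_pos hδ]
  rw [one_lt_div hδ, one_lt_div hu]
  constructor
  · rintro ⟨-, hbest⟩
    by_contra! hcon
    have hne : v / w ≠ t / u := by
      rw [Ne, div_eq_div_iff hw.ne' hu.ne']
      intro he
      linarith
    have := hbest v w ⟨hw, _, _, Or.inl h.swap⟩ hne hcon.2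
    rw [habs, abs_of_pos hε] at this
    exact this.not_ge hcon.1
  · intro hor
    refine ⟨⟨hu, _, _, Or.inl h⟩, fun r s hrs hne hsu => ?_⟩
    obtain ⟨hs, r', s', hrs⟩ := hrs
    rw [habs]
    -- coordinates of `(r, s)` in the basis of the columns
    obtain ⟨x, hx⟩ : ∃ x, x = r * w - s * v := ⟨_, rfl⟩
    obtain ⟨y, hy⟩ : ∃ y, y = t * s - u * r := ⟨_, rfl⟩
    have hxi := (hrs.isIntOrSqrtTwoMulInt_cross (Or.inl h.swap)).eq_zero_or_one_le_abs
    have hyi : t * s - u * r = 0 ∨ 1 ≤ |t * s - u * r| :=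
      (H4.isIntOrSqrtTwoMulInt_cross (Or.inl h) hrs).eq_zero_or_one_le_abs
    rw [← hx] at hxi
    rw [← hy] at hyi
    have hsxy : s = u * x + w * y := by rw [hx, hy]; linear_combination (-s) * hdet
    have hdist : s * α - r = y * (w * α - v) - x * (t - u * α) := by
      rw [hx, hy]; linear_combination (r - s * α) * hdet
    have hy0 : y ≠ 0 := by
      rintro rfl
      apply hne
      rw [div_eq_div_iff hs.ne' hu.ne']
      linarith
    have hyi := hyi.resolve_left hy0
    rw [hdist]
    rcases hxi with rfl | hxi
    · have hypos : 0 < y := by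
        by_contra! hle
        nlinarith
      rw [abs_of_pos hypos] at hyi
      rcases hor with hor | hor
      · refine lt_of_lt_of_le ?_ (le_abs_self _)
        nlinarith
      · nlinarith
    · rcases le_abs.1 hxi with hx1 | hx1 <;> rcases le_abs.1 hyi with hy1 | hy1
      · nlinarith
      · refine lt_of_lt_of_le ?_ (neg_le_abs _)
        nlinarith
      · refine lt_of_lt_of_le ?_ (le_abs_self _)
        nlinarith
      · nlinarith

theorem tn_un_best_iff (α : ℝ) (hα : 0 < α) (hirr : NotSqrt2Rat α)
    (d : ℕ → ℕ)
    (hd : ∀ n : ℕ, 1 ≤ n → d n = 1 ∨ d n = 2 ∨ d n = 3)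
    (hmem : ∀ n : ℕ, 1 ≤ n → vn d n < wn d n * α ∧ un d n * α < tn d n)
    (m : ℕ) (hm : ∀ n : ℕ, 1 ≤ n → n ≤ m → d n = 3) (hm1 : d (m + 1) ≠ 3)
    (n : ℕ) (hn : m + 1 ≤ n) :
    IsBest α (tn d n) (un d n) ↔ (1 < alphan d α n ∨ 1 < alphast d n) := by
  obtain ⟨hv, ht⟩ := hmem n (by omega)
  exact isBest_iff_of_H4form (H4form_entries d hd n) (un_pos d hd hm1 hn)
    (un_nonneg_and_wn_pos d hd n).2 hv ht
end
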